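/- Let ℓ ∈ ℤ and y > 0. Suppose there is a sequence (aₙ, sₙ) with aₙ > 0 and sₙ > 0 converging to (0, y), such that for every n the following holds: every differentiable function θ : ℝ → ℝ satisfying θ'(τ) = aₙ·cos θ(τ) + ℓ + sₙ·cos τ for all τ ∈ ℝ satisfies θ(2π) − θ(0) ∈ 2πℤ. Then J_ℓ(y) = 0, where J_ℓ is the ℓ-th Bessel function given by J_ℓ(x) = (1/π)·∫₀^π cos(ℓτ − x·sin τ) dτ. -/

import Mathlib

/-- The `ℓ`-th Bessel function of the first kind, `J_ℓ(x) = (1/π)∫₀^π cos(ℓτ − x sin τ) dτ`. -/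
noncomputable def besselJ (ℓ : ℤ) (x : ℝ) : ℝ :=
  (1/Real.pi) * ∫ τ in (0:ℝ)..Real.pi, Real.cos ((ℓ:ℝ)*τ - x*Real.sin τ)

open Set Filter Topology

/-- Global existence for the Josephson equation. -/
theorem jos_exists_global (a l s : ℝ) (ha : 0 < a) (hs : 0 < s) :
    ∃ θ : ℝ → ℝ, θ 0 = 0 ∧
      ∀ t, HasDerivAt θ (a * Real.cos (θ t) + l + s * Real.cos t) t := by
  set v : ℝ → ℝ → ℝ := fun t x => a * Real.cos x + l + s * Real.cos t with hv
  have hlip : ∀ t, LipschitzWith (Real.toNNReal a) (v t) := by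
    intro t
    apply LipschitzWith.of_dist_le_mul
    intro x y
    rw [Real.coe_toNNReal _ ha.le, Real.dist_eq, Real.dist_eq]
    have h1 : v t x - v t y = a * (Real.cos x - Real.cos y) := by simp only [hv]; ring
    rw [h1, abs_mul, abs_of_pos ha]
    exact mul_le_mul_of_nonneg_left (Real.abs_cos_sub_cos_le x y) ha.le
  have hbound : ∀ t x, ‖v t x‖ ≤ a + |l| + s := by
    intro t x
    have h1 := abs_le.1 (Real.abs_cos_le_one x)
    have h2 := abs_le.1 (Real.abs_cos_le_one t)
    have h3 := le_abs_self l
    have h4 := neg_abs_le l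
    rw [Real.norm_eq_abs, abs_le]
    simp only [hv]
    constructor <;> nlinarith
  have hloc : ∀ N : ℕ, ∃ α : ℝ → ℝ, α 0 = 0 ∧
      ∀ t ∈ Ioo (-((N:ℝ) + 1)) ((N:ℝ) + 1), HasDerivAt α (v t (α t)) t := by
    intro N
    have hN : (0:ℝ) < (N:ℝ) + 1 := by positivity
    have h0 : (0:ℝ) ∈ Icc (-((N:ℝ) + 1)) ((N:ℝ) + 1) := ⟨by linarith, by linarith⟩
    have hL : 0 ≤ a + |l| + s := by positivity
    have hPL : IsPicardLindelof v (⟨0, h0⟩ : Icc (-((N:ℝ) + 1)) ((N:ℝ) + 1)) (0:ℝ)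
        (Real.toNNReal ((a + |l| + s) * ((N:ℝ) + 1))) 0 (Real.toNNReal (a + |l| + s))
        (Real.toNNReal a) := by
      refine ⟨fun t _ => (hlip t).lipschitzOnWith, fun x _ => ?_, fun t _ x _ => ?_, ?_⟩
      · simp only [hv]; fun_prop
      · rw [Real.coe_toNNReal _ hL]; exact hbound t x
      · rw [Real.coe_toNNReal _ hL, Real.coe_toNNReal _ (by positivity)]
        simp
    obtain ⟨α, h1, h2⟩ := hPL.exists_eq_forall_mem_Icc_hasDerivWithinAt₀
    exact ⟨α, h1, fun t ht => (h2 t (Ioo_subset_Icc_self ht)).hasDerivAt (Icc_mem_nhds ht.1 ht.2)⟩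
  choose α hα0 hα using hloc
  have heq : ∀ N M : ℕ, N ≤ M → EqOn (α N) (α M) (Ioo (-((N:ℝ) + 1)) ((N:ℝ) + 1)) := by
    intro N M hNM
    have hN : (0:ℝ) < (N:ℝ) + 1 := by positivity
    have hNM' : (N:ℝ) ≤ M := by exact_mod_cast hNM
    refine ODE_solution_unique_of_mem_Ioo (v := v) (s := fun _ => univ) (t₀ := 0)
      (K := Real.toNNReal a)
      (fun t _ => (hlip t).lipschitzOnWith) ⟨by linarith, hN⟩
      (fun t ht => ⟨hα N t ht, mem_univ _⟩)
      (fun t ht => ⟨hα M t ⟨by linarith [ht.1], by linarith [ht.2]⟩, mem_univ _⟩) ?_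
    rw [hα0, hα0]
  have hmem : ∀ t : ℝ, t ∈ Ioo (-(((⌈|t|⌉₊ : ℕ):ℝ) + 1)) (((⌈|t|⌉₊ : ℕ):ℝ) + 1) := by
    intro t
    have h := Nat.le_ceil |t|
    exact ⟨by linarith [neg_abs_le t], by linarith [le_abs_self t]⟩
  have hθ : ∀ (M : ℕ) (t : ℝ), t ∈ Ioo (-((M:ℝ) + 1)) ((M:ℝ) + 1) → α ⌈|t|⌉₊ t = α M t := by
    intro M t ht
    rcases le_total ⌈|t|⌉₊ M with h | h
    · exact heq _ _ h (hmem t)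
    · exact (heq _ _ h ht).symm
  refine ⟨fun t => α ⌈|t|⌉₊ t, hα0 _, fun t => ?_⟩
  refine (hα _ t (hmem t)).congr_of_eventuallyEq ?_
  filter_upwards [Ioo_mem_nhds (hmem t).1 (hmem t).2] with u hu
  exact hθ _ u hu

/-- Quantitative estimate at a constriction with small `a`. -/
theorem jos_estimate (ℓ : ℤ) (y a s : ℝ) (ha : 0 < a) (ha1 : a < 1) (hs : 0 < s)
    (hc : ∀ θ : ℝ → ℝ, Differentiable ℝ θ →
      (∀ τ : ℝ, deriv θ τ = a * Real.cos (θ τ) + (ℓ:ℝ) + s * Real.cos τ) →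
      ∃ k : ℤ, θ (2*Real.pi) - θ 0 = 2*Real.pi*(k:ℝ)) :
    |∫ τ in (0:ℝ)..(2*Real.pi), Real.cos ((ℓ:ℝ)*τ + y*Real.sin τ)|
      ≤ (a * (2*Real.pi) + |s - y|) * (2*Real.pi) := by
  have hpi := Real.pi_pos
  obtain ⟨θ, h0, hd⟩ := jos_exists_global a ℓ s ha hs
  obtain ⟨k, hk⟩ := hc θ (fun t => (hd t).differentiableAt) (fun t => (hd t).deriv)
  have hcont : Continuous θ := continuous_iff_continuousAt.2 fun t => (hd t).continuousAt
  set φ : ℝ → ℝ := fun t => θ t - (ℓ:ℝ)*t - s * Real.sin t with hφ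
  have hφd : ∀ t, HasDerivAt φ (a * Real.cos (θ t)) t := by
    intro t
    have := ((hd t).sub ((hasDerivAt_id t).const_mul (ℓ:ℝ))).sub
      ((Real.hasDerivAt_sin t).const_mul s)
    refine this.congr_deriv ?_
    ring
  have hφb : ∀ t, |φ t| ≤ a * |t| := by
    intro t
    have := Convex.norm_image_sub_le_of_norm_hasDerivWithin_le (f := φ) (s := univ)
      (C := a) (x := 0) (y := t) (fun x _ => (hφd x).hasDerivWithinAt)
      (fun x _ => by
        rw [Real.norm_eq_abs, abs_mul, abs_of_pos ha]
        exact mul_le_of_le_one_right ha.le (Real.abs_cos_le_one _))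
      convex_univ (mem_univ _) (mem_univ _)
    simpa [hφ, h0] using this
  have hint : ∫ τ in (0:ℝ)..(2*Real.pi), a * Real.cos (θ τ) = φ (2*Real.pi) - φ 0 :=
    intervalIntegral.integral_eq_sub_of_hasDerivAt (fun t _ => hφd t)
      (Continuous.intervalIntegrable (by fun_prop) _ _)
  have hφ2 : φ (2*Real.pi) = 2*Real.pi*((k - ℓ : ℤ):ℝ) := by
    simp only [hφ, Real.sin_two_pi]
    push_cast
    linarith
  have hkl : k - ℓ = 0 := by
    have h1 := hφb (2*Real.pi)
    rw [hφ2, abs_mul, abs_of_pos (by positivity : 0 < 2*Real.pi)] at h1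
    have h2 : |((k - ℓ : ℤ):ℝ)| < 1 := by
      have : (2*Real.pi) * |((k - ℓ : ℤ):ℝ)| < (2*Real.pi) * 1 := by nlinarith
      exact lt_of_mul_lt_mul_left this (by positivity)
    exact Int.abs_lt_one_iff.1 (by exact_mod_cast h2)
  have hI : ∫ τ in (0:ℝ)..(2*Real.pi), Real.cos (θ τ) = 0 := by
    rw [intervalIntegral.integral_const_mul, hφ2, hkl] at hint
    have h00 : φ 0 = 0 := by simp [hφ, h0]
    rw [h00] at hint
    simpa [ha.ne'] using hint
  have hsub : ∫ τ in (0:ℝ)..(2*Real.pi), Real.cos ((ℓ:ℝ)*τ + y*Real.sin τ)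
      = ∫ τ in (0:ℝ)..(2*Real.pi),
        (Real.cos ((ℓ:ℝ)*τ + y*Real.sin τ) - Real.cos (θ τ)) := by
    rw [intervalIntegral.integral_sub (Continuous.intervalIntegrable (by fun_prop) _ _)
      (Continuous.intervalIntegrable (by fun_prop) _ _), hI, sub_zero]
  rw [hsub]
  have := intervalIntegral.norm_integral_le_of_norm_le_const (a := 0) (b := 2*Real.pi)
    (C := a * (2*Real.pi) + |s - y|)
    (f := fun τ => Real.cos ((ℓ:ℝ)*τ + y*Real.sin τ) - Real.cos (θ τ)) (by
      intro t ht
      rw [uIoc_of_le (by positivity)] at ht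
      have h1 := hφb t
      rw [abs_of_pos ht.1] at h1
      have h2 : a * t ≤ a * (2*Real.pi) := mul_le_mul_of_nonneg_left ht.2 ha.le
      have h3 : |(s - y) * Real.sin t| ≤ |s - y| := by
        rw [abs_mul]
        exact mul_le_of_le_one_right (abs_nonneg _) (Real.abs_sin_le_one _)
      calc ‖Real.cos ((ℓ:ℝ)*t + y*Real.sin t) - Real.cos (θ t)‖
          ≤ |(ℓ:ℝ)*t + y*Real.sin t - θ t| := Real.abs_cos_sub_cos_le _ _
        _ = |φ t + (s - y) * Real.sin t| := by
            rw [← abs_neg]; congr 1; simp only [hφ]; ring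
        _ ≤ |φ t| + |(s - y) * Real.sin t| := abs_add_le _ _
        _ ≤ _ := by linarith)
  simpa [abs_of_pos hpi] using this

/-- The integral over a full period in terms of the Bessel integral. -/
theorem jos_bessel (ℓ : ℤ) (y : ℝ)
    (h : ∫ τ in (0:ℝ)..(2*Real.pi), Real.cos ((ℓ:ℝ)*τ + y*Real.sin τ) = 0) :
    besselJ ℓ y = 0 := by
  set g : ℝ → ℝ := fun τ => Real.cos ((ℓ:ℝ)*τ + y*Real.sin τ) with hg
  set B := ∫ τ in (0:ℝ)..Real.pi, Real.cos ((ℓ:ℝ)*τ - y*Real.sin τ) with hB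
  have hgc : Continuous g := by simp only [hg]; fun_prop
  have hsplit : (∫ τ in (0:ℝ)..Real.pi, g τ) + ∫ τ in Real.pi..(2*Real.pi), g τ = 0 := by
    rw [intervalIntegral.integral_add_adjacent_intervals (hgc.intervalIntegrable _ _)
      (hgc.intervalIntegrable _ _)]
    exact h
  have hsh : ∫ τ in Real.pi..(2*Real.pi), g τ = ∫ τ in (0:ℝ)..Real.pi, g τ := by
    have := intervalIntegral.integral_comp_sub_left g (2*Real.pi) (a := 0) (b := Real.pi)
    rw [sub_zero, show 2*Real.pi - Real.pi = Real.pi by ring] at this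
    rw [← this]
    refine intervalIntegral.integral_congr fun t _ => ?_
    simp only [hg]
    rw [Real.sin_two_pi_sub, ← Real.cos_neg ((ℓ:ℝ)*t + _),
      ← Real.cos_add_int_mul_two_pi (-((ℓ:ℝ)*t + _)) ℓ]
    congr 1; ring
  have hI : ∫ τ in (0:ℝ)..Real.pi, g τ = 0 := by linarith
  have hflip : ∫ τ in (0:ℝ)..Real.pi, g τ = (-1)^ℓ * B := by
    have := intervalIntegral.integral_comp_sub_left g Real.pi (a := 0) (b := Real.pi)
    rw [sub_zero, sub_self] at this
    rw [← this, hB, ← intervalIntegral.integral_const_mul]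
    refine intervalIntegral.integral_congr fun t _ => ?_
    simp only [hg]
    rw [Real.sin_pi_sub, ← Real.cos_neg ((ℓ:ℝ)*t - _), ← Real.cos_add_int_mul_pi (-((ℓ:ℝ)*t - _))]
    congr 1; ring
  have hB0 : B = 0 := by
    rw [hflip] at hI
    rcases mul_eq_zero.1 hI with h | h
    · exact absurd h (zpow_ne_zero _ (by norm_num))
    · exact h
  rw [besselJ, ← hB, hB0, mul_zero]

/-- If points `(aₙ, sₙ)` of the constriction set `Constr_ℓ` (i.e. parameters for which the
period-`2π` Poincaré map of equation (jostor) is the identity) with `aₙ, sₙ > 0` converge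
to `(0, y)` with `y > 0`, then `J_ℓ(y) = 0`. -/
theorem stmt_16 (ℓ : ℤ) (y : ℝ) (hy : 0 < y)
    (aseq sseq : ℕ → ℝ) (hapos : ∀ n, 0 < aseq n) (hspos : ∀ n, 0 < sseq n)
    (hconv : Filter.Tendsto (fun n => (aseq n, sseq n)) Filter.atTop (nhds (0, y)))
    (hconstr : ∀ n, ∀ θ : ℝ → ℝ, Differentiable ℝ θ →
      (∀ τ : ℝ, deriv θ τ = aseq n * Real.cos (θ τ) + (ℓ:ℝ) + sseq n * Real.cos τ) →
      ∃ k : ℤ, θ (2*Real.pi) - θ 0 = 2*Real.pi*(k:ℝ)) :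
    besselJ ℓ y = 0 := by
  apply jos_bessel
  have ha : Tendsto aseq atTop (𝓝 0) := (continuous_fst.tendsto _).comp hconv
  have hs : Tendsto sseq atTop (𝓝 y) := (continuous_snd.tendsto _).comp hconv
  have hlim : Tendsto (fun n => (aseq n * (2*Real.pi) + |sseq n - y|) * (2*Real.pi))
      atTop (𝓝 0) := by
    have h1 := ((ha.mul_const (2*Real.pi)).add (hs.sub_const y).abs).mul_const (2*Real.pi)
    simpa using h1
  have hle : |∫ τ in (0:ℝ)..(2*Real.pi), Real.cos ((ℓ:ℝ)*τ + y*Real.sin τ)| ≤ 0 := by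
    refine ge_of_tendsto hlim ?_
    filter_upwards [ha.eventually_lt_const (zero_lt_one)] with n hn
    exact jos_estimate ℓ y _ _ (hapos n) hn (hspos n) (hconstr n)
  exact abs_nonpos_iff.1 hle
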